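/- Assume f₁ ≥ 0 on [0,1]. Let u : ℝ×[0,∞) → [0,1] belong to C([0,∞); L¹_loc(ℝ)) and satisfy the weak formulation ∫₀^∞∫_ℝ u ∂_tψ dx dt + ∫_ℝ u(x,0) ψ(x,0) dx + ∫₀^∞ Σ_{i=1,2} ∫_{Ω_i} f_i(u) ∂_xψ dx dt = 0 for every smooth test function ψ compactly supported in ℝ×[0,∞). Assume moreover that for almost every t > 0, lim_{n→∞} n ∫_{-1/n}^0 f₁(u(x,t)) dx = 0 (i.e. u admits a strong trace ū₁ at x = 0⁻ with f₁(ū₁) = 0). Then the quantity of oil standing in (-R,0) can only grow: for every R > 0 and all 0 ≤ t₁ ≤ t₂, ∫_{-R}^0 u(x,t₁) dx ≤ ∫_{-R}^0 u(x,t₂) dx. -/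

import Mathlib

open MeasureTheory Set Filter

noncomputable section

open scoped Topology

theorem one_le_mul_sub {c k x : ℝ} (hk : 0 < k) (hx : c + k⁻¹ ≤ x) : 1 ≤ k * (x - c) := by
  have := mul_le_mul_of_nonneg_left (show k⁻¹ ≤ x - c by linarith) hk.le
  rwa [mul_inv_cancel₀ hk.ne'] at this

namespace Real.smoothTransition

theorem differentiable : Differentiable ℝ smoothTransition :=
  (smoothTransition.contDiff (n := 1)).differentiable (by simp)

theorem continuous_deriv : Continuous (deriv smoothTransition) :=
  (smoothTransition.contDiff (n := 1)).continuous_deriv (by simp)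

theorem deriv_nonneg (x : ℝ) : 0 ≤ deriv smoothTransition x :=
  smoothTransition.monotone.deriv_nonneg

theorem deriv_of_nonpos {x : ℝ} (hx : x ≤ 0) : deriv smoothTransition x = 0 :=
  IsLocalMin.deriv_eq_zero <| Eventually.of_forall fun y => by
    rw [zero_of_nonpos hx]; exact nonneg y

theorem deriv_of_one_le {x : ℝ} (hx : 1 ≤ x) : deriv smoothTransition x = 0 :=
  IsLocalMax.deriv_eq_zero <| Eventually.of_forall fun y => by
    rw [one_of_one_le hx]; exact le_one y

theorem support_deriv_subset : Function.support (deriv smoothTransition) ⊆ Ioc 0 1 := by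
  intro x hx
  by_contra h
  rcases le_or_gt x 0 with h0 | h0
  · exact hx (deriv_of_nonpos h0)
  · exact hx (deriv_of_one_le (not_le.1 fun h1 => h ⟨h0, h1⟩).le)

theorem exists_deriv_le : ∃ C : ℝ, 0 ≤ C ∧ ∀ x, deriv smoothTransition x ≤ C := by
  obtain ⟨C, hC⟩ := (isCompact_Icc (a := (0 : ℝ)) (b := 1)).exists_bound_of_continuousOn
    continuous_deriv.continuousOn
  refine ⟨max C 0, le_max_right _ _, fun x => ?_⟩
  by_cases hx : x ∈ Icc (0 : ℝ) 1
  · exact (le_abs_self _).trans ((hC x hx).trans (le_max_left _ _))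
  · rw [Function.notMem_support.1 fun h => hx (Ioc_subset_Icc_self (support_deriv_subset h))]
    exact le_max_right _ _

theorem integral_deriv : ∫ y in (0 : ℝ)..1, deriv smoothTransition y = 1 := by
  rw [intervalIntegral.integral_deriv_eq_sub (fun x _ => differentiable x)
    (continuous_deriv.intervalIntegrable _ _)]
  simp

/-- A rescaled derivative of `smoothTransition` is an approximate identity: it averages a function
to the right of `a`. -/
theorem integral_deriv_comp_mul {k : ℝ} (hk : 0 < k) (a : ℝ) (Q : ℝ → ℝ) :
    ∫ t, k * deriv smoothTransition (k * (t - a)) * Q t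
      = ∫ y in (0 : ℝ)..1, deriv smoothTransition y * Q (a + k⁻¹ * y) := by
  let G : ℝ → ℝ := fun y => k * (deriv smoothTransition y * Q (a + k⁻¹ * y))
  have h1 : ∀ t, k * deriv smoothTransition (k * (t - a)) * Q t = G (k * (t - a)) := by
    intro t
    simp only [G, inv_mul_cancel_left₀ hk.ne', add_sub_cancel, mul_assoc]
  simp_rw [h1]
  rw [integral_sub_right_eq_self (fun t => G (k * t)) a, Measure.integral_comp_mul_left G k,
    abs_of_pos (inv_pos.2 hk), intervalIntegral.integral_eq_integral_of_support_subset]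
  · simp only [G, integral_const_mul, smul_eq_mul, inv_mul_cancel_left₀ hk.ne']
  · exact (Function.support_mul_subset_left _ _).trans support_deriv_subset

theorem tendsto_integral_deriv_comp_mul (a : ℝ) {Q : ℝ → ℝ} (hQ : Continuous Q) :
    Tendsto (fun k : ℝ => ∫ t, k * deriv smoothTransition (k * (t - a)) * Q t) atTop (𝓝 (Q a)) := by
  have hc : Continuous fun s : ℝ =>
      ∫ y in (0 : ℝ)..1, deriv smoothTransition y * Q (a + s * y) := by
    apply intervalIntegral.continuous_parametric_intervalIntegral_of_continuous'
    have := continuous_deriv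
    fun_prop
  have h0 := (hc.tendsto 0).comp tendsto_inv_atTop_zero
  simp only [zero_mul, add_zero, intervalIntegral.integral_mul_const, integral_deriv,
    one_mul] at h0
  refine h0.congr' ?_
  filter_upwards [eventually_gt_atTop 0] with k hk
  exact (integral_deriv_comp_mul hk a Q).symm

theorem integrable_deriv_comp_mul {k : ℝ} (hk : 0 < k) (a : ℝ) {Q : ℝ → ℝ} (hQ : Continuous Q) :
    Integrable fun t => k * deriv smoothTransition (k * (t - a)) * Q t := by
  refine Continuous.integrable_of_hasCompactSupport ?_ ?_
  · have := continuous_deriv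
    fun_prop
  · refine HasCompactSupport.intro (isCompact_Icc (a := a) (b := a + k⁻¹)) fun t ht => ?_
    rcases lt_or_ge t a with h | h
    · rw [deriv_of_nonpos (mul_nonpos_of_nonneg_of_nonpos hk.le (by linarith))]; ring
    · have h2 : a + k⁻¹ < t := by
        by_contra h2
        exact ht ⟨h, not_lt.1 h2⟩
      rw [deriv_of_one_le (one_le_mul_sub hk h2.le)]
      ring

end Real.smoothTransition

open Real (smoothTransition)
open Real.smoothTransition

/-- A smooth plateau that rises from `0` to `1` on `[a, a + k⁻¹]` and falls back to `0` on
`[b, b + k⁻¹]`. -/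
def smoothPlateau (a b k x : ℝ) : ℝ :=
  smoothTransition (k * (x - a)) - smoothTransition (k * (x - b))

namespace smoothPlateau

variable {a b k x : ℝ}

theorem contDiff (a b k : ℝ) : ContDiff ℝ (⊤ : ℕ∞) (smoothPlateau a b k) := by
  unfold smoothPlateau
  exact (smoothTransition.contDiff.comp (by fun_prop)).sub
    (smoothTransition.contDiff.comp (by fun_prop))

theorem continuous (a b k : ℝ) : Continuous (smoothPlateau a b k) :=
  (contDiff a b k).continuous

theorem deriv_eq (a b k x : ℝ) :
    deriv (smoothPlateau a b k) x = k * deriv smoothTransition (k * (x - a))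
      - k * deriv smoothTransition (k * (x - b)) := by
  have h : ∀ c, HasDerivAt (fun y => smoothTransition (k * (y - c)))
      (k * deriv smoothTransition (k * (x - c))) x := by
    intro c
    have h1 : HasDerivAt (fun y => k * (y - c)) k x := by
      simpa using ((hasDerivAt_id x).sub_const c).const_mul k
    simpa [mul_comm, Function.comp_def] using!
      (differentiable (k * (x - c))).hasDerivAt.comp x h1
  exact ((h a).sub (h b)).deriv

theorem nonneg (hk : 0 ≤ k) (hab : a ≤ b) (x : ℝ) : 0 ≤ smoothPlateau a b k x :=
  sub_nonneg.2 <| smoothTransition.monotone <| by gcongr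

theorem le_one (a b k x : ℝ) : smoothPlateau a b k x ≤ 1 := by
  have h1 := Real.smoothTransition.le_one (k * (x - a))
  have h2 := Real.smoothTransition.nonneg (k * (x - b))
  unfold smoothPlateau
  linarith

theorem of_le (hk : 0 ≤ k) (hab : a ≤ b) (hx : x ≤ a) : smoothPlateau a b k x = 0 := by
  unfold smoothPlateau
  rw [zero_of_nonpos (mul_nonpos_of_nonneg_of_nonpos hk (by linarith)),
    zero_of_nonpos (mul_nonpos_of_nonneg_of_nonpos hk (by linarith)), sub_zero]

theorem of_ge (hk : 0 < k) (hab : a ≤ b) (hx : b + k⁻¹ ≤ x) : smoothPlateau a b k x = 0 := by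
  unfold smoothPlateau
  rw [one_of_one_le (one_le_mul_sub hk hx), one_of_one_le (one_le_mul_sub hk (by linarith)),
    sub_self]

theorem eq_one (hk : 0 < k) (ha : a + k⁻¹ ≤ x) (hb : x ≤ b) : smoothPlateau a b k x = 1 := by
  unfold smoothPlateau
  rw [one_of_one_le (one_le_mul_sub hk ha),
    zero_of_nonpos (mul_nonpos_of_nonneg_of_nonpos hk.le (by linarith)), sub_zero]

theorem hasCompactSupport (hk : 0 < k) (hab : a ≤ b) : HasCompactSupport (smoothPlateau a b k) := by
  refine HasCompactSupport.intro (isCompact_Icc (a := a) (b := b + k⁻¹)) fun x hx => ?_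
  rcases le_or_gt x a with h | h
  · exact of_le hk.le hab h
  · exact of_ge hk hab (not_le.1 fun h1 => hx ⟨h.le, h1⟩).le

end smoothPlateau

/-- A continuous function on `[0, ∞)` with nonnegative distributional derivative is monotone. -/
theorem monotoneOn_Ici_of_integral_deriv_mul_nonpos {Q : ℝ → ℝ} (hQ : ContinuousOn Q (Ici 0))
    (h : ∀ θ : ℝ → ℝ, ContDiff ℝ (⊤ : ℕ∞) θ → HasCompactSupport θ → (∀ t, 0 ≤ θ t) → θ 0 = 0 →
      ∫ t in Ioi (0 : ℝ), deriv θ t * Q t ≤ 0) :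
    MonotoneOn Q (Ici 0) := by
  intro a ha b hb hab
  let P : ℝ → ℝ := fun t => Q (max t 0)
  have hP : Continuous P := by
    refine continuousOn_univ.1 (hQ.comp (by fun_prop) fun t _ => ?_)
    exact le_max_right t 0
  have hPeq : ∀ t, 0 ≤ t → P t = Q t := fun t ht => by simp only [P, max_eq_left ht]
  have hlim := (tendsto_integral_deriv_comp_mul a hP).sub (tendsto_integral_deriv_comp_mul b hP)
  rw [hPeq a ha, hPeq b hb] at hlim
  refine sub_nonpos.1 (le_of_tendsto hlim ?_)
  filter_upwards [eventually_gt_atTop 0] with k hk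
  rw [← integral_sub (integrable_deriv_comp_mul hk a hP) (integrable_deriv_comp_mul hk b hP)]
  refine le_of_eq_of_le ?_ (h (smoothPlateau a b k) (smoothPlateau.contDiff a b k)
    (smoothPlateau.hasCompactSupport hk hab) (smoothPlateau.nonneg hk.le hab)
    (smoothPlateau.of_le hk.le hab ha))
  simp_rw [← sub_mul, ← smoothPlateau.deriv_eq]
  rw [← setIntegral_eq_integral_of_forall_compl_eq_zero (s := Ioi 0)]
  · exact setIntegral_congr_fun measurableSet_Ioi fun t ht => by simp only [hPeq t (le_of_lt ht)]
  · intro t ht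
    have ht : t ≤ 0 := not_lt.1 ht
    rw [mem_Ici] at ha hb
    rw [smoothPlateau.deriv_eq,
      deriv_of_nonpos (mul_nonpos_of_nonneg_of_nonpos hk.le (by linarith)),
      deriv_of_nonpos (mul_nonpos_of_nonneg_of_nonpos hk.le (by linarith))]
    ring

section Truncation

variable {v : ℝ → ℝ} {R k : ℝ}

/-- The plateau function approximating the indicator of `(-R, 0)` from inside. -/
abbrev innerPlateau (R k : ℝ) : ℝ → ℝ := smoothPlateau (-R) (-k⁻¹) k

theorem norm_mul_innerPlateau_le (hk : 0 < k) (hkR : k⁻¹ ≤ R)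
    (hv01 : ∀ x, v x ∈ Icc (0 : ℝ) 1) (x : ℝ) :
    ‖v x * innerPlateau R k x‖ ≤ (Ioo (-R) 0).indicator (fun _ => (1 : ℝ)) x := by
  have hab : -R ≤ -k⁻¹ := neg_le_neg hkR
  by_cases hx : x ∈ Ioo (-R) 0
  · rw [indicator_of_mem hx, norm_mul, Real.norm_of_nonneg (hv01 x).1,
      Real.norm_of_nonneg (smoothPlateau.nonneg hk.le hab x)]
    exact mul_le_one₀ (hv01 x).2 (smoothPlateau.nonneg hk.le hab x) (smoothPlateau.le_one ..)
  · rw [indicator_of_notMem hx]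
    rcases le_or_gt x (-R) with h | h
    · simp [innerPlateau, smoothPlateau.of_le hk.le hab h]
    · have h0 : 0 ≤ x := not_lt.1 fun h1 => hx ⟨h, h1⟩
      simp [innerPlateau, smoothPlateau.of_ge (x := x) hk hab (by linarith)]

theorem integrable_indicator_Ioo_one (a b : ℝ) :
    Integrable ((Ioo a b).indicator fun _ => (1 : ℝ)) :=
  (integrable_indicator_iff measurableSet_Ioo).2 (integrableOn_const (by simp))

theorem norm_integral_mul_innerPlateau_le (hR : 0 < R) (hk : 0 < k) (hkR : k⁻¹ ≤ R)
    (hv01 : ∀ x, v x ∈ Icc (0 : ℝ) 1) : ‖∫ x, v x * innerPlateau R k x‖ ≤ R := by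
  refine (norm_integral_le_of_norm_le (integrable_indicator_Ioo_one (-R) 0)
    (Eventually.of_forall (norm_mul_innerPlateau_le hk hkR hv01))).trans_eq ?_
  rw [integral_indicator measurableSet_Ioo]
  simp [hR.le]

theorem tendsto_integral_mul_innerPlateau (hR : 0 < R) (hv : Measurable v)
    (hv01 : ∀ x, v x ∈ Icc (0 : ℝ) 1) :
    Tendsto (fun k : ℝ => ∫ x, v x * innerPlateau R k x) atTop (𝓝 (∫ x in Ioo (-R) 0, v x)) := by
  rw [← integral_indicator measurableSet_Ioo]
  have hsmall : ∀ δ > (0 : ℝ), ∀ᶠ k : ℝ in atTop, k⁻¹ ≤ δ := fun δ hδ =>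
    (tendsto_inv_atTop_zero.eventually (gt_mem_nhds hδ)).mono fun _ h => h.le
  refine tendsto_integral_filter_of_dominated_convergence _ ?_ ?_
    (integrable_indicator_Ioo_one (-R) 0) ?_
  · exact Eventually.of_forall fun k =>
      (hv.mul (smoothPlateau.continuous _ _ _).measurable).aestronglyMeasurable
  · filter_upwards [eventually_gt_atTop 0, hsmall R hR] with k hk hkR
    exact Eventually.of_forall (norm_mul_innerPlateau_le hk hkR hv01)
  · refine Eventually.of_forall fun x => tendsto_const_nhds.congr' ?_
    by_cases hx : x ∈ Ioo (-R) 0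
    · rw [indicator_of_mem hx]
      filter_upwards [eventually_gt_atTop 0, hsmall (x + R) (by linarith [hx.1]),
        hsmall (-x) (by linarith [hx.2])] with k hk h1 h2
      rw [innerPlateau, smoothPlateau.eq_one hk (by linarith) (by linarith), mul_one]
    · filter_upwards [eventually_gt_atTop 0, hsmall R hR] with k hk hkR
      have := norm_mul_innerPlateau_le hk hkR hv01 x
      rw [indicator_of_notMem hx] at this
      rw [indicator_of_notMem hx, norm_le_zero_iff.1 this]

/-- Only the descending part of the plateau, located next to the origin, contributes negatively. -/
theorem neg_le_setIntegral_mul_deriv_innerPlateau {C B : ℝ}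
    (hC : ∀ x, deriv smoothTransition x ≤ C) (hk : 0 < k) (hkR : k⁻¹ ≤ R)
    (hv : Measurable v) (hv0 : ∀ x, 0 ≤ v x) (hvB : ∀ x, v x ≤ B) :
    -(C * (k * ∫ x in Ioo (-k⁻¹) 0, v x)) ≤
      ∫ x in Iio (0 : ℝ), v x * deriv (innerPlateau R k) x := by
  have hab : -R ≤ -k⁻¹ := neg_le_neg hkR
  have hrw : -(C * (k * ∫ x in Ioo (-k⁻¹) 0, v x)) =
      ∫ x in Iio (0 : ℝ), (Ioo (-k⁻¹) 0).indicator (fun x => -(C * k) * v x) x := by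
    rw [setIntegral_indicator measurableSet_Ioo, inter_eq_right.2 Ioo_subset_Iio_self,
      integral_const_mul]
    ring
  rw [hrw]
  refine setIntegral_mono_on ?_ ?_ measurableSet_Iio ?_
  · refine Integrable.integrableOn ((integrable_indicator_iff measurableSet_Ioo).2 ?_)
    refine (Measure.integrableOn_of_bounded (M := B) (by simp) hv.aestronglyMeasurable ?_).const_mul _
    exact Eventually.of_forall fun x => by
      rw [Real.norm_of_nonneg (hv0 x)]; exact hvB x
  · refine Integrable.integrableOn (Integrable.bdd_mul (c := B) ?_ hv.aestronglyMeasurable ?_)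
    · exact ((smoothPlateau.contDiff _ _ _).continuous_deriv (by simp)).integrable_of_hasCompactSupport
        (smoothPlateau.hasCompactSupport hk hab).deriv
    · exact Eventually.of_forall fun x => by
        rw [Real.norm_of_nonneg (hv0 x)]; exact hvB x
  · intro x hx
    rw [innerPlateau, smoothPlateau.deriv_eq]
    have h1 := mul_nonneg hk.le (deriv_nonneg (k * (x - -R)))
    by_cases hxk : x ∈ Ioo (-k⁻¹) 0
    · rw [indicator_of_mem hxk]
      have h2 := mul_le_mul_of_nonneg_left (hC (k * (x - -k⁻¹))) hk.le
      nlinarith [hv0 x]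
    · rw [indicator_of_notMem hxk]
      have hx' : x ≤ -k⁻¹ := not_lt.1 fun h => hxk ⟨h, hx⟩
      rw [deriv_of_nonpos (x := k * (x - -k⁻¹))
        (mul_nonpos_of_nonneg_of_nonpos hk.le (by linarith))]
      nlinarith [hv0 x]

theorem deriv_innerPlateau_of_nonneg (hk : 0 < k) (hkR : k⁻¹ ≤ R) {x : ℝ} (hx : 0 ≤ x) :
    deriv (innerPlateau R k) x = 0 := by
  have := inv_pos.2 hk
  rw [innerPlateau, smoothPlateau.deriv_eq,
    deriv_of_one_le (one_le_mul_sub hk (by linarith)),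
    deriv_of_one_le (one_le_mul_sub hk (by linarith))]
  ring

end Truncation

/-- The weak formulation, tested against a plateau in space times `θ` in time. -/
theorem integral_deriv_mul_innerPlateau_le {u g h : ℝ → ℝ → ℝ} {R k C B : ℝ}
    (hC0 : 0 ≤ C) (hC : ∀ x, deriv smoothTransition x ≤ C) (hk : 0 < k) (hkR : k⁻¹ ≤ R)
    (hg : Measurable fun p : ℝ × ℝ => g p.1 p.2) (hg0 : ∀ x t, 0 ≤ g x t) (hgB : ∀ x t, g x t ≤ B)
    (hweak : ∀ ψ : ℝ → ℝ → ℝ, ContDiff ℝ (⊤ : ℕ∞) (fun p : ℝ × ℝ => ψ p.1 p.2) →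
      HasCompactSupport (fun p : ℝ × ℝ => ψ p.1 p.2) →
      (∫ t in Ioi (0 : ℝ), ∫ x : ℝ, u x t * deriv (fun s => ψ x s) t)
      + (∫ x : ℝ, u x 0 * ψ x 0)
      + (∫ t in Ioi (0 : ℝ),
          (∫ x in Iio (0 : ℝ), g x t * deriv (fun y => ψ y t) x)
        + (∫ x in Ioi (0 : ℝ), h x t * deriv (fun y => ψ y t) x)) = 0)
    {θ : ℝ → ℝ} (hθ : ContDiff ℝ (⊤ : ℕ∞) θ) (hθc : HasCompactSupport θ) (hθ0 : ∀ t, 0 ≤ θ t)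
    (hθz : θ 0 = 0)
    (hint : IntegrableOn (fun t => θ t * (k * ∫ x in Ioo (-k⁻¹) 0, g x t)) (Ioi 0)) :
    ∫ t in Ioi (0 : ℝ), deriv θ t * ∫ x, u x t * innerPlateau R k x ≤
      C * ∫ t in Ioi (0 : ℝ), θ t * (k * ∫ x in Ioo (-k⁻¹) 0, g x t) := by
  have hab : -R ≤ -k⁻¹ := neg_le_neg hkR
  have hw := hweak (fun x t => innerPlateau R k x * θ t)
    (((smoothPlateau.contDiff _ _ _).comp contDiff_fst).mul (hθ.comp contDiff_snd)) (by
      refine HasCompactSupport.intro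
        ((smoothPlateau.hasCompactSupport hk hab).isCompact.prod hθc.isCompact) fun p hp => ?_
      by_contra hne
      exact hp ⟨subset_tsupport _ (left_ne_zero_of_mul hne),
        subset_tsupport _ (right_ne_zero_of_mul hne)⟩)
  simp only [hθz, mul_zero, integral_zero, add_zero, deriv_const_mul_field',
    deriv_mul_const_field'] at hw
  have hright : ∀ t, ∫ x in Ioi (0 : ℝ), h x t * deriv (innerPlateau R k) x = 0 :=
    fun t => setIntegral_eq_zero_of_forall_eq_zero fun x hx => by
      rw [deriv_innerPlateau_of_nonneg hk hkR (le_of_lt hx), mul_zero]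
  simp only [← mul_assoc, integral_mul_const, hright, zero_mul, add_zero] at hw
  simp_rw [mul_comm (deriv θ _)]
  have hlow : -(C * ∫ t in Ioi (0 : ℝ), θ t * (k * ∫ x in Ioo (-k⁻¹) 0, g x t)) ≤
      ∫ t in Ioi (0 : ℝ), (∫ x in Iio (0 : ℝ), g x t * deriv (innerPlateau R k) x) * θ t := by
    by_cases hA : IntegrableOn (fun t =>
        (∫ x in Iio (0 : ℝ), g x t * deriv (innerPlateau R k) x) * θ t) (Ioi 0)
    · rw [← integral_const_mul, ← integral_neg]
      refine integral_mono (hint.const_mul C).neg hA fun t => ?_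
      have := mul_le_mul_of_nonneg_right (neg_le_setIntegral_mul_deriv_innerPlateau hC hk hkR
        (hg.comp (measurable_id.prodMk measurable_const)) (hg0 · t) (hgB · t)) (hθ0 t)
      dsimp only [Function.comp_def, id] at this ⊢
      linarith
    · rw [integral_undef hA, neg_nonpos]
      refine mul_nonneg hC0 (integral_nonneg fun t => mul_nonneg (hθ0 t) (mul_nonneg hk.le ?_))
      exact integral_nonneg fun x => hg0 x t
  linarith

/-- Continuity in time of the mass in `(-R, 0)`. -/
theorem continuousOn_setIntegral_of_tendsto_abs_sub {u : ℝ → ℝ → ℝ} {R : ℝ}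
    (hrange : ∀ x t, u x t ∈ Icc (0 : ℝ) 1) (hmeas : ∀ t, Measurable fun x => u x t)
    (hcont : ∀ t₀ : ℝ, 0 ≤ t₀ → ∀ K : Set ℝ, IsCompact K →
      Tendsto (fun t => ∫ x in K, |u x t - u x t₀|) (𝓝[Ici 0] t₀) (𝓝 0)) :
    ContinuousOn (fun t => ∫ x in Ioo (-R) 0, u x t) (Ici 0) := by
  have hint : ∀ t, IntegrableOn (fun x => u x t) (Icc (-R) 0) := fun t =>
    Measure.integrableOn_of_bounded (M := 1) (by simp) (hmeas t).aestronglyMeasurable <|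
      Eventually.of_forall fun x => by
        rw [Real.norm_of_nonneg (hrange x t).1]; exact (hrange x t).2
  intro t₀ ht₀
  refine tendsto_iff_norm_sub_tendsto_zero.2 <|
    squeeze_zero (fun _ => norm_nonneg _) (fun t => ?_) (hcont t₀ ht₀ (Icc (-R) 0) isCompact_Icc)
  simp only [← integral_Icc_eq_integral_Ioo]
  rw [← integral_sub (hint t) (hint t₀)]
  exact norm_integral_le_integral_norm _

/-- Oil-trapping: if `f₁ ≥ 0`, `u` is a weak solution of the two-flux conservation law
(with `q = 0`), `u` is continuous in time with values in `L¹_loc`, and the flux of `u`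
vanishes at the interface `{x = 0}` from the left (strong trace `ū₁` with `f₁(ū₁) = 0`),
then the quantity of oil in `(-R,0)` can only grow in time. -/
theorem stmt4 (f₁ f₂ : ℝ → ℝ)
    (hf₁lip : ∃ K : NNReal, LipschitzOnWith K f₁ (Icc 0 1))
    (hf₂lip : ∃ K : NNReal, LipschitzOnWith K f₂ (Icc 0 1))
    (hf₁pos : ∀ s ∈ Icc (0:ℝ) 1, 0 ≤ f₁ s)
    (u : ℝ → ℝ → ℝ)
    (hrange : ∀ x t, u x t ∈ Icc (0:ℝ) 1)
    (hmeas : Measurable (fun p : ℝ × ℝ => u p.1 p.2))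
    -- `u ∈ C([0,∞); L¹_loc(ℝ))`
    (hcont : ∀ t₀ : ℝ, 0 ≤ t₀ → ∀ K : Set ℝ, IsCompact K →
      Tendsto (fun t => ∫ x in K, |u x t - u x t₀|) (nhdsWithin t₀ (Ici 0)) (nhds 0))
    -- weak formulation
    (hweak : ∀ ψ : ℝ → ℝ → ℝ, ContDiff ℝ (⊤ : ℕ∞) (fun p : ℝ × ℝ => ψ p.1 p.2) →
      HasCompactSupport (fun p : ℝ × ℝ => ψ p.1 p.2) →
      (∫ t in Ioi (0:ℝ), ∫ x : ℝ, u x t * deriv (fun s => ψ x s) t)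
      + (∫ x : ℝ, u x 0 * ψ x 0)
      + (∫ t in Ioi (0:ℝ),
          (∫ x in Iio (0:ℝ), f₁ (u x t) * deriv (fun y => ψ y t) x)
        + (∫ x in Ioi (0:ℝ), f₂ (u x t) * deriv (fun y => ψ y t) x)) = 0)
    -- vanishing of the flux at the interface (strong trace with `f₁(ū₁) = 0`)
    (htrace : ∀ᵐ t : ℝ, 0 < t →
      Tendsto (fun n : ℕ => (n : ℝ) * ∫ x in Ioo (-(1/(n:ℝ))) 0, f₁ (u x t))
        atTop (nhds 0)) :
    ∀ R : ℝ, 0 < R → ∀ t₁ t₂ : ℝ, 0 ≤ t₁ → t₁ ≤ t₂ →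
      (∫ x in Ioo (-R) 0, u x t₁) ≤ ∫ x in Ioo (-R) 0, u x t₂ := by
  intro R hR t₁ t₂ ht₁ ht₁₂
  have hslice : ∀ t, Measurable fun x => u x t := fun t =>
    hmeas.comp (measurable_id.prodMk measurable_const)
  obtain ⟨K, hK⟩ := hf₁lip
  obtain ⟨F, hF, hFeq⟩ := hK.extend_real
  have hg : Measurable fun p : ℝ × ℝ => f₁ (u p.1 p.2) := by
    simp_rw [fun p : ℝ × ℝ => hFeq (hrange p.1 p.2)]
    exact hF.continuous.measurable.comp hmeas
  have hg0 : ∀ x t, 0 ≤ f₁ (u x t) := fun x t => hf₁pos _ (hrange x t)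
  obtain ⟨B, hB⟩ := (isCompact_Icc (a := (0 : ℝ)) (b := 1)).exists_bound_of_continuousOn
    hK.continuousOn
  have hgB : ∀ x t, f₁ (u x t) ≤ B := fun x t => (le_abs_self _).trans (hB _ (hrange x t))
  obtain ⟨C, hC0, hC⟩ := exists_deriv_le
  refine monotoneOn_Ici_of_integral_deriv_mul_nonpos
    (continuousOn_setIntegral_of_tendsto_abs_sub hrange hslice hcont) ?_ ht₁
    (ht₁.trans ht₁₂ : 0 ≤ t₂) ht₁₂
  intro θ hθ hθc hθ0 hθz
  let E : ℕ → ℝ → ℝ := fun n t => (n : ℝ) * ∫ x in Ioo (-(n : ℝ)⁻¹) 0, f₁ (u x t)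
  have hEmeas : ∀ n, Measurable (E n) := fun n =>
    (hg.stronglyMeasurable.integral_prod_left' (μ := volume.restrict _)).measurable.const_mul _
  have hθint : IntegrableOn θ (Ioi 0) :=
    (hθ.continuous.integrable_of_hasCompactSupport hθc).integrableOn
  have hθ'int : IntegrableOn (deriv θ) (Ioi 0) :=
    ((hθ.continuous_deriv (by simp)).integrable_of_hasCompactSupport hθc.deriv).integrableOn
  have hEB : ∀ n : ℕ, 0 < n → ∀ t, ‖E n t‖ ≤ B := by
    intro n hn t
    have hn' : (0 : ℝ) < n := Nat.cast_pos.2 hn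
    have h1 : ‖∫ x in Ioo (-(n : ℝ)⁻¹) 0, f₁ (u x t)‖ ≤ B * (n : ℝ)⁻¹ := by
      have := norm_setIntegral_le_of_norm_le_const (μ := volume) (s := Ioo (-(n : ℝ)⁻¹) 0)
        (f := fun x => f₁ (u x t)) (by simp) fun x _ => hB _ (hrange x t)
      simpa [hn'.le] using this
    rw [norm_mul, Real.norm_of_nonneg hn'.le]
    calc (n : ℝ) * ‖∫ x in Ioo (-(n : ℝ)⁻¹) 0, f₁ (u x t)‖ ≤ n * (B * (n : ℝ)⁻¹) := by gcongr
      _ = B := by field_simp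
  have hbound : ∀ n : ℕ, 0 < n → ∀ t, ‖θ t * E n t‖ ≤ θ t * B := fun n hn t => by
    rw [norm_mul, Real.norm_of_nonneg (hθ0 t)]
    exact mul_le_mul_of_nonneg_left (hEB n hn t) (hθ0 t)
  have hθE : ∀ n, AEStronglyMeasurable (fun t => θ t * E n t) (volume.restrict (Ioi 0)) :=
    fun n => (hθ.continuous.measurable.mul (hEmeas n)).aestronglyMeasurable
  have hflux : Tendsto (fun n : ℕ => C * ∫ t in Ioi (0 : ℝ), θ t * E n t) atTop (𝓝 0) := by
    have := tendsto_integral_filter_of_dominated_convergence (μ := volume.restrict (Ioi (0 : ℝ)))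
      (f := fun _ => (0 : ℝ)) (l := atTop) (F := fun n t => θ t * E n t) (fun t => θ t * B)
      (Eventually.of_forall hθE)
      ((eventually_gt_atTop 0).mono fun n hn => Eventually.of_forall (hbound n hn))
      (hθint.mul_const B) (by
        filter_upwards [ae_restrict_mem measurableSet_Ioi, ae_restrict_of_ae htrace] with t ht h
        simpa [E, one_div] using (h ht).const_mul (θ t))
    simpa using this.const_mul C
  have hsmall : ∀ᶠ n : ℕ in atTop, 0 < n ∧ (n : ℝ)⁻¹ ≤ R :=
    (eventually_gt_atTop 0).and <|
      (tendsto_inv_atTop_nhds_zero_nat.eventually (gt_mem_nhds hR)).mono fun _ h => h.le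
  have hmass : Tendsto
      (fun n : ℕ => ∫ t in Ioi (0 : ℝ), deriv θ t * ∫ x, u x t * innerPlateau R n x) atTop
      (𝓝 (∫ t in Ioi (0 : ℝ), deriv θ t * ∫ x in Ioo (-R) 0, u x t)) := by
    refine tendsto_integral_filter_of_dominated_convergence (fun t => ‖deriv θ t‖ * R)
      (Eventually.of_forall fun n => ?_) ?_ (hθ'int.norm.mul_const R)
      (Eventually.of_forall fun t => ?_)
    · refine ((measurable_deriv θ).mul ?_).aestronglyMeasurable
      exact ((hmeas.mul ((smoothPlateau.continuous _ _ _).measurable.comp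
        measurable_fst)).stronglyMeasurable.integral_prod_left' (μ := volume)).measurable
    · filter_upwards [hsmall] with n hn
      refine Eventually.of_forall fun t => ?_
      rw [norm_mul]
      gcongr
      exact norm_integral_mul_innerPlateau_le hR (Nat.cast_pos.2 hn.1) hn.2 (hrange · t)
    · exact ((tendsto_integral_mul_innerPlateau hR (hslice t) (hrange · t)).comp
        tendsto_natCast_atTop_atTop).const_mul _
  refine le_of_tendsto_of_tendsto hmass hflux ?_
  filter_upwards [hsmall] with n hn
  exact integral_deriv_mul_innerPlateau_le hC0 hC (Nat.cast_pos.2 hn.1) hn.2 hg hg0 hgB hweak hθ hθc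
    hθ0 hθz ((hθint.mul_const B).mono' (hθE n) (Eventually.of_forall (hbound n hn.1)))
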